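/- arXiv:1207.5363 — 2 statements merged into one kernel-verified Lean document; each statement's English description precedes it below -/
import Mathlib

section
/- Let H be a cocommutative weak Hopf algebra over a commutative ring k, (A, φ_A) a weak left H-module algebra, and σ ∈ Reg_{φ_A}(H⊗H, A) with convolution inverse σ^{-1}. Then: (i) σ∘(η_H⊗H) = u₁ if and only if σ^{-1}∘(η_H⊗H) = u₁; and (ii) σ∘(H⊗η_H) = u₁ if and only if σ^{-1}∘(H⊗η_H) = u₁. -/
open TensorProduct

noncomputable section

namespace WHA

variable (k : Type) [CommRing k]

/-- Generalized convolution product of two linear maps from a "coalgebra"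
(given by a comultiplication `δC`) to a module `P` with a product `m`. -/
def convG {C P : Type} [AddCommGroup C] [Module k C] [AddCommGroup P] [Module k P]
    (δC : C →ₗ[k] C ⊗[k] C) (m : P ⊗[k] P →ₗ[k] P) (f g : C →ₗ[k] P) : C →ₗ[k] P :=
  m ∘ₗ TensorProduct.map f g ∘ₗ δC

/-- Convolution product of two linear maps from a "coalgebra" to an algebra. -/
def conv {C A : Type} [AddCommGroup C] [Module k C] [Ring A] [Algebra k A]
    (δC : C →ₗ[k] C ⊗[k] C) (f g : C →ₗ[k] A) : C →ₗ[k] A :=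
  convG k δC (LinearMap.mul' k A) f g

variable (H : Type) [Ring H] [Algebra k H]

/-- The structure maps (comultiplication, counit, antipode) of a prospective
weak Hopf algebra on the `k`-algebra `H`. -/
structure HopfData where
  δ : H →ₗ[k] H ⊗[k] H
  ε : H →ₗ[k] k
  lam : H →ₗ[k] H

variable {k H}

/-- The target map `Π^L_H = ((ε∘μ)⊗H)∘(H⊗c)∘((δ∘η)⊗H)`. -/
def PiL (W : HopfData k H) : H →ₗ[k] H :=
  (TensorProduct.rid k H).toLinearMap
    ∘ₗ LinearMap.lTensor H (W.ε ∘ₗ LinearMap.mul' k H)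
    ∘ₗ (TensorProduct.assoc k H H H).toLinearMap
    ∘ₗ LinearMap.rTensor H (TensorProduct.comm k H H).toLinearMap
    ∘ₗ TensorProduct.mk k (H ⊗[k] H) H (W.δ 1)

/-- The source map `Π^R_H = (H⊗(ε∘μ))∘(c⊗H)∘(H⊗(δ∘η))`. -/
def PiR (W : HopfData k H) : H →ₗ[k] H :=
  (TensorProduct.lid k H).toLinearMap
    ∘ₗ LinearMap.rTensor H (W.ε ∘ₗ LinearMap.mul' k H)
    ∘ₗ (TensorProduct.assoc k H H H).symm.toLinearMap
    ∘ₗ LinearMap.lTensor H (TensorProduct.comm k H H).toLinearMap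
    ∘ₗ (TensorProduct.mk k H (H ⊗[k] H)).flip (W.δ 1)

/-- `H` together with the data `W` is a weak Hopf algebra. -/
structure IsWeakHopf (W : HopfData k H) : Prop where
  coassoc : ∀ h : H,
    (TensorProduct.assoc k H H H) ((LinearMap.rTensor H W.δ) (W.δ h)) =
      (LinearMap.lTensor H W.δ) (W.δ h)
  counit_left : ∀ h : H, (TensorProduct.lid k H) ((LinearMap.rTensor H W.ε) (W.δ h)) = h
  counit_right : ∀ h : H, (TensorProduct.rid k H) ((LinearMap.lTensor H W.ε) (W.δ h)) = h
  a1 : ∀ x y : H, W.δ (x * y) = W.δ x * W.δ y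
  a2 : ∀ x y z : H, W.ε (x * y * z) =
    LinearMap.mul' k k ((TensorProduct.map (W.ε ∘ₗ LinearMap.mulLeft k x)
      (W.ε ∘ₗ LinearMap.mulRight k z)) (W.δ y))
  a2' : ∀ x y z : H, W.ε (x * y * z) =
    LinearMap.mul' k k ((TensorProduct.map (W.ε ∘ₗ LinearMap.mulLeft k x)
      (W.ε ∘ₗ LinearMap.mulRight k z)) ((TensorProduct.comm k H H) (W.δ y)))
  a3 : (TensorProduct.assoc k H H H) ((LinearMap.rTensor H W.δ) (W.δ 1)) =
    (TensorProduct.map LinearMap.id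
        (Algebra.TensorProduct.includeLeft : H →ₐ[k] H ⊗[k] H).toLinearMap) (W.δ 1) *
      (Algebra.TensorProduct.includeRight : (H ⊗[k] H) →ₐ[k] H ⊗[k] (H ⊗[k] H)).toLinearMap
        (W.δ 1)
  a3' : (TensorProduct.assoc k H H H) ((LinearMap.rTensor H W.δ) (W.δ 1)) =
    (Algebra.TensorProduct.includeRight : (H ⊗[k] H) →ₐ[k] H ⊗[k] (H ⊗[k] H)).toLinearMap
        (W.δ 1) *
      (TensorProduct.map LinearMap.id
        (Algebra.TensorProduct.includeLeft : H →ₐ[k] H ⊗[k] H).toLinearMap) (W.δ 1)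
  a4_left : ∀ h : H,
    LinearMap.mul' k H ((TensorProduct.map LinearMap.id W.lam) (W.δ h)) = PiL W h
  a4_right : ∀ h : H,
    LinearMap.mul' k H ((TensorProduct.map W.lam LinearMap.id) (W.δ h)) = PiR W h
  a4_mid : conv k W.δ (conv k W.δ W.lam LinearMap.id) W.lam = W.lam

/-- `H` is cocommutative. -/
def Cocomm (W : HopfData k H) : Prop :=
  ∀ h : H, (TensorProduct.comm k H H) (W.δ h) = W.δ h

section ComodAlg

variable {A : Type} [Ring A] [Algebra k A]

/-- The map `ζ_A = (μ_A⊗H)∘(A⊗c_{H,A})∘((ρ_A∘η_A)⊗A)`; in the tensor product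
algebra `A ⊗ H` it is given by `a ↦ ρ(1) * (a ⊗ 1)`. -/
def zeta (ρ : A →ₗ[k] A ⊗[k] H) (a : A) : A ⊗[k] H :=
  ρ 1 * (a ⊗ₜ[k] (1 : H))

/-- `a` is a coinvariant element, i.e. belongs to `A_H`. -/
def IsCoinv (ρ : A →ₗ[k] A ⊗[k] H) (a : A) : Prop :=
  ρ a = zeta ρ a

/-- `(A, ρ)` is a right `H`-comodule algebra. -/
structure IsComodAlg (W : HopfData k H) (ρ : A →ₗ[k] A ⊗[k] H) : Prop where
  coassoc : ∀ a : A, (TensorProduct.assoc k A H H) ((LinearMap.rTensor H ρ) (ρ a)) =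
    (LinearMap.lTensor A W.δ) (ρ a)
  counit : ∀ a : A, (TensorProduct.rid k A) ((LinearMap.lTensor A W.ε) (ρ a)) = a
  mul_compat : ∀ a b : A, ρ (a * b) = ρ a * ρ b
  unit_coinv : (LinearMap.lTensor A (PiL W)) (ρ 1) = ρ 1

end ComodAlg

/-- For `t = Σ x ⊗ y : B ⊗ H`, the map `h ↦ Σ ε(h*y) • x`.  For
`t = ρ(1)` this is the map `e_A = (A⊗ε)∘Γ∘(H⊗η)`. -/
def eGen (W : HopfData k H) {B : Type} [AddCommGroup B] [Module k B]
    (t : B ⊗[k] H) : H →ₗ[k] B :=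
  (TensorProduct.lid k B).toLinearMap
    ∘ₗ LinearMap.rTensor B (W.ε ∘ₗ LinearMap.mul' k H)
    ∘ₗ (TensorProduct.assoc k H H B).symm.toLinearMap
    ∘ₗ LinearMap.lTensor H (TensorProduct.comm k B H).toLinearMap
    ∘ₗ (TensorProduct.mk k H (B ⊗[k] H)).flip t

/-- For `t = Σ x ⊗ y : B ⊗ H`, the map `h ↦ Σ ε(y*h) • x`.  For
`t = ρ(1)` this is the map `(A⊗(ε∘μ))∘((ρ∘η)⊗H)`. -/
def dGen (W : HopfData k H) {B : Type} [AddCommGroup B] [Module k B]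
    (t : B ⊗[k] H) : H →ₗ[k] B :=
  (TensorProduct.rid k B).toLinearMap
    ∘ₗ LinearMap.lTensor B (W.ε ∘ₗ LinearMap.mul' k H)
    ∘ₗ (TensorProduct.assoc k B H H).toLinearMap
    ∘ₗ TensorProduct.mk k (B ⊗[k] H) H t

section ComodAlg2

variable {A : Type} [Ring A] [Algebra k A]

/-- The entwining map `Γ_A^H = (A⊗μ_H)∘(c_{H,A}⊗H)∘(H⊗ρ_A)`. -/
def Γmap (ρ : A →ₗ[k] A ⊗[k] H) : H ⊗[k] A →ₗ[k] A ⊗[k] H :=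
  LinearMap.lTensor A (LinearMap.mul' k H)
    ∘ₗ (TensorProduct.assoc k A H H).toLinearMap
    ∘ₗ LinearMap.rTensor H (TensorProduct.comm k H A).toLinearMap
    ∘ₗ (TensorProduct.assoc k H A H).symm.toLinearMap
    ∘ₗ LinearMap.lTensor H ρ

/-- `f : H → A` is an integral, i.e. a morphism of right `H`-comodules. -/
def IsIntegral (W : HopfData k H) (ρ : A →ₗ[k] A ⊗[k] H) (f : H →ₗ[k] A) : Prop :=
  ∀ h : H, ρ (f h) = (LinearMap.rTensor H f) (W.δ h)

/-- `finv` is the convolution inverse of the integral `f` (conditions (c1)-(c3)). -/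
def IsConvInv (W : HopfData k H) (ρ : A →ₗ[k] A ⊗[k] H) (f finv : H →ₗ[k] A) : Prop :=
  conv k W.δ finv f = eGen W (ρ 1) ∧
  conv k W.δ f finv = dGen W (ρ 1) ∧
  conv k W.δ (conv k W.δ finv f) finv = finv

/-- `f` is a cleaving morphism (with convolution inverse `finv`) for the extension
`A_H ↪ A`, i.e. a convolution invertible integral such that `f ∧ f⁻¹` takes
values in the coinvariants. -/
def IsCleaving (W : HopfData k H) (ρ : A →ₗ[k] A ⊗[k] H) (f finv : H →ₗ[k] A) : Prop :=
  IsIntegral W ρ f ∧ IsConvInv W ρ f finv ∧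
    ∀ h : H, IsCoinv ρ (conv k W.δ f finv h)

end ComodAlg2

section ModAlg

variable {B : Type} [Ring B] [Algebra k B]

/-- `u₁ = φ ∘ (H ⊗ η_B)`. -/
def u1 (φ : H ⊗[k] B →ₗ[k] B) : H →ₗ[k] B :=
  φ ∘ₗ (TensorProduct.mk k H B).flip 1

/-- `u₂ = u₁ ∘ μ_H`. -/
def u2 (φ : H ⊗[k] B →ₗ[k] B) : H ⊗[k] H →ₗ[k] B :=
  u1 φ ∘ₗ LinearMap.mul' k H

/-- `(B, φ)` is a weak left `H`-module algebra (conditions (d1)-(d4)). -/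
def IsWeakModAlg (W : HopfData k H) (φ : H ⊗[k] B →ₗ[k] B) : Prop :=
  (∀ b : B, φ ((1 : H) ⊗ₜ[k] b) = b) ∧
  (∀ (h : H) (b c : B), φ (h ⊗ₜ[k] (b * c)) =
    LinearMap.mul' k B ((TensorProduct.map (φ ∘ₗ (TensorProduct.mk k H B).flip b)
      (φ ∘ₗ (TensorProduct.mk k H B).flip c)) (W.δ h))) ∧
  (∀ g h : H, φ ((g * h) ⊗ₜ[k] (1 : B)) = φ (g ⊗ₜ[k] φ (h ⊗ₜ[k] (1 : B)))) ∧
  (∀ (h : H) (b : B), φ (PiL W h ⊗ₜ[k] b) = φ (h ⊗ₜ[k] (1 : B)) * b)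

/-- `(B, φ)` is a left `H`-module algebra. -/
def IsModAlg (W : HopfData k H) (φ : H ⊗[k] B →ₗ[k] B) : Prop :=
  IsWeakModAlg W φ ∧
    ∀ (g h : H) (b : B), φ ((g * h) ⊗ₜ[k] b) = φ (g ⊗ₜ[k] φ (h ⊗ₜ[k] b))

/-- `(h, hinv)` is a pair of mutually convolution inverse elements in
`Reg_{φ}(H,B)`. -/
def IsRegPair (W : HopfData k H) (φ : H ⊗[k] B →ₗ[k] B) (h hinv : H →ₗ[k] B) : Prop :=
  conv k W.δ h hinv = u1 φ ∧ conv k W.δ hinv h = u1 φ ∧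
  conv k W.δ (conv k W.δ h hinv) h = h ∧
  conv k W.δ (conv k W.δ hinv h) hinv = hinv

end ModAlg

/-- The comultiplication of the tensor product coalgebra `H ⊗ H`. -/
def δ2 (W : HopfData k H) : H ⊗[k] H →ₗ[k] (H ⊗[k] H) ⊗[k] (H ⊗[k] H) :=
  (TensorProduct.tensorTensorTensorComm k H H H H).toLinearMap
    ∘ₗ TensorProduct.map W.δ W.δ

/-- The comultiplication of the tensor product coalgebra `H ⊗ (H ⊗ H)`. -/
def δ3 (W : HopfData k H) :
    H ⊗[k] (H ⊗[k] H) →ₗ[k] (H ⊗[k] (H ⊗[k] H)) ⊗[k] (H ⊗[k] (H ⊗[k] H)) :=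
  (TensorProduct.tensorTensorTensorComm k H H (H ⊗[k] H) (H ⊗[k] H)).toLinearMap
    ∘ₗ TensorProduct.map W.δ (δ2 W)

section ModAlg2

variable {B : Type} [Ring B] [Algebra k B]

/-- `(σ, σinv)` is a pair of mutually convolution inverse elements in
`Reg_{φ}(H⊗H,B)`. -/
def IsRegPair2 (W : HopfData k H) (φ : H ⊗[k] B →ₗ[k] B)
    (σ σinv : H ⊗[k] H →ₗ[k] B) : Prop :=
  conv k (δ2 W) σ σinv = u2 φ ∧ conv k (δ2 W) σinv σ = u2 φ ∧
  conv k (δ2 W) (conv k (δ2 W) σ σinv) σ = σ ∧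
  conv k (δ2 W) (conv k (δ2 W) σinv σ) σinv = σinv

/-- Condition (g1) (the twisted condition). -/
def CrossedG1 (W : HopfData k H) (φ : H ⊗[k] B →ₗ[k] B) (σ : H ⊗[k] H →ₗ[k] B) : Prop :=
  ∀ (x y : H) (b : B),
    LinearMap.mul' k B ((TensorProduct.map σ
        ((φ ∘ₗ (TensorProduct.mk k H B).flip b) ∘ₗ LinearMap.mul' k H))
      (δ2 W (x ⊗ₜ[k] y))) =
    LinearMap.mul' k B ((TensorProduct.map
        (φ ∘ₗ LinearMap.lTensor H (φ ∘ₗ (TensorProduct.mk k H B).flip b)) σ)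
      (δ2 W (x ⊗ₜ[k] y)))

/-- Condition (g2) (the cocycle condition). -/
def CrossedG2 (W : HopfData k H) (φ : H ⊗[k] B →ₗ[k] B) (σ : H ⊗[k] H →ₗ[k] B) : Prop :=
  conv k (δ3 W) (φ ∘ₗ LinearMap.lTensor H σ)
      (σ ∘ₗ LinearMap.lTensor H (LinearMap.mul' k H)) =
  conv k (δ3 W)
      ((TensorProduct.rid k B).toLinearMap ∘ₗ TensorProduct.map σ W.ε
        ∘ₗ (TensorProduct.assoc k H H H).symm.toLinearMap)
      (σ ∘ₗ LinearMap.rTensor H (LinearMap.mul' k H)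
        ∘ₗ (TensorProduct.assoc k H H H).symm.toLinearMap)

/-- Condition (g3) (the normal condition). -/
def CrossedG3 (W : HopfData k H) (φ : H ⊗[k] B →ₗ[k] B) (σ : H ⊗[k] H →ₗ[k] B) : Prop :=
  ∀ h : H, σ (h ⊗ₜ[k] (1 : H)) = u1 φ h ∧ σ ((1 : H) ⊗ₜ[k] h) = u1 φ h

/-- `(φ, σ)` is a crossed system for `H` over `B`, with `σinv` the convolution
inverse of `σ`. -/
def IsCrossedSystem (W : HopfData k H) (φ : H ⊗[k] B →ₗ[k] B)
    (σ σinv : H ⊗[k] H →ₗ[k] B) : Prop :=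
  IsWeakModAlg W φ ∧ IsRegPair2 W φ σ σinv ∧
    CrossedG1 W φ σ ∧ CrossedG2 W φ σ ∧ CrossedG3 W φ σ

/-- The condition that `h` conjugates the weak action `ϕ` into `φ`. -/
def FisEq (W : HopfData k H) (φ ϕ : H ⊗[k] B →ₗ[k] B) (h hinv : H →ₗ[k] B) : Prop :=
  ∀ (g : H) (b : B), φ (g ⊗ₜ[k] b) =
    (LinearMap.mul' k B ∘ₗ LinearMap.rTensor B (LinearMap.mul' k B))
      ((TensorProduct.map (TensorProduct.map h (ϕ ∘ₗ (TensorProduct.mk k H B).flip b)) hinv)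
        ((LinearMap.rTensor H W.δ) (W.δ g)))

/-- The condition that `h` transforms the cocycle `τ` into `σ`. -/
def SigmasEq (W : HopfData k H) (ϕ : H ⊗[k] B →ₗ[k] B)
    (σ τ : H ⊗[k] H →ₗ[k] B) (h hinv : H →ₗ[k] B) : Prop :=
  σ = conv k (δ2 W)
    (LinearMap.mul' k B ∘ₗ TensorProduct.map h ϕ
      ∘ₗ (TensorProduct.assoc k H H B).toLinearMap ∘ₗ TensorProduct.map W.δ h)
    (conv k (δ2 W) τ (hinv ∘ₗ LinearMap.mul' k H))

/-- `h` (with convolution inverse `hinv`) realizes an equivalence between the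
crossed systems `(φ, σ)` and `(ϕ, τ)`. -/
def RealizesEquiv (W : HopfData k H) (φ ϕ : H ⊗[k] B →ₗ[k] B)
    (σ τ : H ⊗[k] H →ₗ[k] B) (h hinv : H →ₗ[k] B) : Prop :=
  IsRegPair W φ h hinv ∧ IsRegPair W ϕ h hinv ∧ h 1 = 1 ∧
    FisEq W φ ϕ h hinv ∧ SigmasEq W ϕ σ τ h hinv

/-- The crossed systems `(φ, σ)` and `(ϕ, τ)` are equivalent. -/
def CrossedEquiv (W : HopfData k H) (φ ϕ : H ⊗[k] B →ₗ[k] B)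
    (σ τ : H ⊗[k] H →ₗ[k] B) : Prop :=
  u1 φ = u1 ϕ ∧ ∃ h hinv : H →ₗ[k] B, RealizesEquiv W φ ϕ σ τ h hinv

/-- The map `ψ_H^B = (φ⊗H)∘(H⊗c_{H,B})∘(δ_H⊗B)`. -/
def ψmap (W : HopfData k H) (φ : H ⊗[k] B →ₗ[k] B) : H ⊗[k] B →ₗ[k] B ⊗[k] H :=
  LinearMap.rTensor H φ
    ∘ₗ (TensorProduct.assoc k H B H).symm.toLinearMap
    ∘ₗ LinearMap.lTensor H (TensorProduct.comm k H B).toLinearMap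
    ∘ₗ (TensorProduct.assoc k H H B).toLinearMap
    ∘ₗ LinearMap.rTensor B W.δ

/-- The map `σ_H^B = (σ⊗μ_H)∘δ_{H⊗H}`. -/
def σHA (W : HopfData k H) (σ : H ⊗[k] H →ₗ[k] B) : H ⊗[k] H →ₗ[k] B ⊗[k] H :=
  TensorProduct.map σ (LinearMap.mul' k H) ∘ₗ δ2 W

/-- The idempotent `∇_{B⊗H} = (μ_B⊗H)∘(B⊗ψ_H^B)∘(B⊗H⊗η_B)`. -/
def nabla (W : HopfData k H) (φ : H ⊗[k] B →ₗ[k] B) : B ⊗[k] H →ₗ[k] B ⊗[k] H :=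
  LinearMap.rTensor H (LinearMap.mul' k B)
    ∘ₗ (TensorProduct.assoc k B B H).symm.toLinearMap
    ∘ₗ LinearMap.lTensor B (ψmap W φ)
    ∘ₗ LinearMap.lTensor B ((TensorProduct.mk k H B).flip 1)

/-- The product `(μ_B⊗H)∘(μ_B⊗σ_H^B)∘(B⊗ψ_H^B⊗H)` on `B ⊗ H`. -/
def crossmulAmb (W : HopfData k H) (φ : H ⊗[k] B →ₗ[k] B) (σ : H ⊗[k] H →ₗ[k] B) :
    (B ⊗[k] H) ⊗[k] (B ⊗[k] H) →ₗ[k] B ⊗[k] H :=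
  LinearMap.rTensor H (LinearMap.mul' k B)
    ∘ₗ (TensorProduct.assoc k B B H).symm.toLinearMap
    ∘ₗ LinearMap.lTensor B (LinearMap.rTensor H (LinearMap.mul' k B))
    ∘ₗ LinearMap.lTensor B ((TensorProduct.assoc k B B H).symm.toLinearMap)
    ∘ₗ LinearMap.lTensor B (LinearMap.lTensor B (σHA W σ))
    ∘ₗ LinearMap.lTensor B ((TensorProduct.assoc k B H H).toLinearMap)
    ∘ₗ LinearMap.lTensor B (LinearMap.rTensor H (ψmap W φ))
    ∘ₗ LinearMap.lTensor B ((TensorProduct.assoc k H B H).symm.toLinearMap)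
    ∘ₗ (TensorProduct.assoc k B H (B ⊗[k] H)).toLinearMap

end ModAlg2

section CrossProd

variable {B : Type} [Ring B] [Algebra k B]
variable {P : Type} [AddCommGroup P] [Module k P]

/-- The product of the weak crossed product `B ×_σ H`, through a splitting
`(P, p, ι)` of the idempotent `∇_{B⊗H}`. -/
def crossMul (W : HopfData k H) (φ : H ⊗[k] B →ₗ[k] B) (σ : H ⊗[k] H →ₗ[k] B)
    (p : B ⊗[k] H →ₗ[k] P) (ι : P →ₗ[k] B ⊗[k] H) : P ⊗[k] P →ₗ[k] P :=
  p ∘ₗ crossmulAmb W φ σ ∘ₗ TensorProduct.map ι ι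

/-- The unit of the weak crossed product `B ×_σ H`. -/
def crossUnit (W : HopfData k H) (φ : H ⊗[k] B →ₗ[k] B)
    (p : B ⊗[k] H →ₗ[k] P) : P :=
  p (nabla W φ ((1 : B) ⊗ₜ[k] (1 : H)))

/-- The coaction `ρ_{B×H} = (p⊗H)∘(B⊗δ_H)∘ι` of the weak crossed product. -/
def crossCoact (W : HopfData k H)
    (p : B ⊗[k] H →ₗ[k] P) (ι : P →ₗ[k] B ⊗[k] H) : P →ₗ[k] P ⊗[k] H :=
  LinearMap.rTensor H p ∘ₗ (TensorProduct.assoc k B H H).symm.toLinearMap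
    ∘ₗ LinearMap.lTensor B W.δ ∘ₗ ι

/-- The inclusion `i_{B×H} = p∘(B⊗η_H) : B → B × H`. -/
def crossInc (p : B ⊗[k] H →ₗ[k] P) : B →ₗ[k] P :=
  p ∘ₗ (TensorProduct.mk k B H).flip 1

/-- The analogue of `ζ` for an abstract module `P` with product `m`:
`ζ(x) = t · (x ⊗ 1)` where `t` plays the role of `ρ(1)`. -/
def zetaGen (m : P ⊗[k] P →ₗ[k] P) (t : P ⊗[k] H) (x : P) : P ⊗[k] H :=
  (TensorProduct.map m (LinearMap.mul' k H))
    ((TensorProduct.tensorTensorTensorComm k P H P H) (t ⊗ₜ[k] (x ⊗ₜ[k] (1 : H))))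

end CrossProd

section Induced

variable {D P : Type} [AddCommGroup D] [Module k D] [AddCommGroup P] [Module k P]

/-- The map `(P⊗P)⊗P → P`, `(x⊗y)⊗z ↦ x·(z·y)`. -/
def mulSwizG (m : P ⊗[k] P →ₗ[k] P) : (P ⊗[k] P) ⊗[k] P →ₗ[k] P :=
  m ∘ₗ LinearMap.lTensor P (m ∘ₗ (TensorProduct.comm k P P).toLinearMap)
    ∘ₗ (TensorProduct.assoc k P P P).toLinearMap

/-- The ambient weak action `μ∘(P⊗(μ∘c))∘(((f⊗f⁻¹)∘δ_H)⊗j) : H ⊗ D → P`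
induced by a cleaving morphism `f`. -/
def phiAmb (W : HopfData k H) (m : P ⊗[k] P →ₗ[k] P) (f finv : H →ₗ[k] P)
    (j : D →ₗ[k] P) : H ⊗[k] D →ₗ[k] P :=
  mulSwizG m ∘ₗ TensorProduct.map ((TensorProduct.map f finv) ∘ₗ W.δ) j

/-- The ambient cocycle `(μ∘(f⊗f)) ∧ (f⁻¹∘μ_H) : H ⊗ H → P` induced by a
cleaving morphism `f`. -/
def sigmaAmb (W : HopfData k H) (m : P ⊗[k] P →ₗ[k] P) (f finv : H →ₗ[k] P) :
    H ⊗[k] H →ₗ[k] P :=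
  convG k (δ2 W) m (m ∘ₗ TensorProduct.map f f) (finv ∘ₗ LinearMap.mul' k H)

end Induced

section Pres

variable {A D : Type} [Ring A] [Algebra k A] [Ring D] [Algebra k D]

/-- `j : D → A` presents `D` as the subalgebra of coinvariants of `A`. -/
def IsCoinvPres (ρ : A →ₗ[k] A ⊗[k] H) (j : D →ₐ[k] A) : Prop :=
  Function.Injective j ∧ ∀ a : A, IsCoinv ρ a ↔ a ∈ Set.range j

end Pres

section NormalCocycle

theorem PiL_apply (W : HopfData k H) (h : H) :
    PiL W h = TensorProduct.lid k H
      (LinearMap.rTensor H (W.ε ∘ₗ LinearMap.mulRight k h) (W.δ 1)) := by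
  simp only [PiL, LinearMap.comp_apply, TensorProduct.mk_apply]
  induction W.δ 1 with
  | zero => simp
  | tmul a b => simp
  | add x y hx hy => simp_all [TensorProduct.add_tmul]

/-- `δ(Π^L(h)) = (Π^L(h) ⊗ 1) δ(1)`. -/
theorem delta_PiL {W : HopfData k H} (hW : IsWeakHopf W) (h : H) :
    W.δ (PiL W h) = (PiL W h ⊗ₜ[k] (1 : H)) * W.δ 1 := by
  have pull : ∀ t : H ⊗[k] H,
      W.δ (TensorProduct.lid k H (LinearMap.rTensor H (W.ε ∘ₗ LinearMap.mulRight k h) t)) =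
        TensorProduct.lid k (H ⊗[k] H)
          (LinearMap.rTensor (H ⊗[k] H) (W.ε ∘ₗ LinearMap.mulRight k h)
            (LinearMap.lTensor H W.δ t)) := by
    intro t
    induction t with
    | zero => simp
    | tmul a b => simp
    | add x y hx hy => simp only [map_add, hx, hy]
  have push : ∀ t s : H ⊗[k] H,
      TensorProduct.lid k (H ⊗[k] H)
          (LinearMap.rTensor (H ⊗[k] H) (W.ε ∘ₗ LinearMap.mulRight k h)
            ((TensorProduct.map LinearMap.id
              (Algebra.TensorProduct.includeLeft : H →ₐ[k] H ⊗[k] H).toLinearMap) t *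
            (Algebra.TensorProduct.includeRight :
              (H ⊗[k] H) →ₐ[k] H ⊗[k] (H ⊗[k] H)).toLinearMap s)) =
        (TensorProduct.lid k H
          (LinearMap.rTensor H (W.ε ∘ₗ LinearMap.mulRight k h) t) ⊗ₜ[k] (1 : H)) * s := by
    intro t s
    induction t with
    | zero => simp
    | tmul a b => simp [← TensorProduct.smul_tmul']
    | add x y hx hy => simp only [map_add, add_mul, TensorProduct.add_tmul, hx, hy]
  rw [PiL_apply, pull, ← hW.coassoc, hW.a3, push]

/-- `(H ⊗ Π^L)(δ(1)) = δ(1)`. -/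
theorem lTensor_PiL_delta_one {W : HopfData k H} (hW : IsWeakHopf W) :
    LinearMap.lTensor H (PiL W) (W.δ 1) = W.δ 1 := by
  have counit : ∀ t : H ⊗[k] H,
      LinearMap.lTensor H ((TensorProduct.lid k H).toLinearMap ∘ₗ LinearMap.rTensor H W.ε)
        (LinearMap.lTensor H W.δ t) = t := by
    intro t
    induction t with
    | zero => simp
    | tmul a b => simp [hW.counit_left]
    | add x y hx hy => simp only [map_add, hx, hy]
  have inner : ∀ (b : H) (s : H ⊗[k] H),
      TensorProduct.lid k H (LinearMap.rTensor H W.ε (s * (b ⊗ₜ[k] (1 : H)))) =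
        TensorProduct.lid k H (LinearMap.rTensor H (W.ε ∘ₗ LinearMap.mulRight k b) s) := by
    intro b s
    induction s with
    | zero => simp
    | tmul a c => simp
    | add x y hx hy => simp only [map_add, add_mul, hx, hy]
  have push : ∀ t : H ⊗[k] H,
      LinearMap.lTensor H ((TensorProduct.lid k H).toLinearMap ∘ₗ LinearMap.rTensor H W.ε)
          ((Algebra.TensorProduct.includeRight :
              (H ⊗[k] H) →ₐ[k] H ⊗[k] (H ⊗[k] H)).toLinearMap (W.δ 1) *
            (TensorProduct.map LinearMap.id
              (Algebra.TensorProduct.includeLeft : H →ₐ[k] H ⊗[k] H).toLinearMap) t) =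
        LinearMap.lTensor H (PiL W) t := by
    intro t
    induction t with
    | zero => simp
    | tmul a b => simp [inner, PiL_apply]
    | add x y hx hy => simp only [map_add, mul_add, hx, hy]
  rw [← push, ← hW.a3', hW.coassoc, counit]

/-- In the cocommutative case, `(Π^L ⊗ H)(δ(1)) = δ(1)`. -/
theorem rTensor_PiL_delta_one {W : HopfData k H} (hW : IsWeakHopf W) (hcc : Cocomm W) :
    LinearMap.rTensor H (PiL W) (W.δ 1) = W.δ 1 := by
  have swap : ∀ t : H ⊗[k] H,
      LinearMap.rTensor H (PiL W) (TensorProduct.comm k H H t) =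
        TensorProduct.comm k H H (LinearMap.lTensor H (PiL W) t) := by
    intro t
    induction t with
    | zero => simp
    | tmul a b => simp
    | add x y hx hy => simp only [map_add, hx, hy]
  rw [← hcc 1, swap, lTensor_PiL_delta_one hW]

variable {B : Type} [Ring B] [Algebra k B]

theorem conv_δ2_tmul (W : HopfData k H) (f g : H ⊗[k] H →ₗ[k] B) (x y : H) :
    conv k (δ2 W) f g (x ⊗ₜ[k] y) =
      LinearMap.mul' k B (TensorProduct.map f g
        (TensorProduct.tensorTensorTensorComm k H H H H (W.δ x ⊗ₜ[k] W.δ y))) := rfl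

theorem u1_PiL {W : HopfData k H} {φ : H ⊗[k] B →ₗ[k] B} (hφ : IsWeakModAlg W φ) (a : H) :
    u1 φ (PiL W a) = u1 φ a := by
  simpa [u1] using hφ.2.2.2 a 1

theorem u1_mul {W : HopfData k H} {φ : H ⊗[k] B →ₗ[k] B} (hφ : IsWeakModAlg W φ) (g h : H) :
    u1 φ (g * h) = φ (g ⊗ₜ[k] u1 φ h) := by
  simpa [u1] using hφ.2.2.1 g h

/-- `u₁` is multiplicative when the left factor lies in the image of `Π^L`. -/
theorem u1_PiL_mul {W : HopfData k H} {φ : H ⊗[k] B →ₗ[k] B} (hφ : IsWeakModAlg W φ) (a h : H) :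
    u1 φ (PiL W a * h) = u1 φ (PiL W a) * u1 φ h := by
  rw [u1_mul hφ, hφ.2.2.2, u1_PiL hφ]
  simp [u1]

theorem flip_u1 {W : HopfData k H} {φ : H ⊗[k] B →ₗ[k] B} (hφ : IsWeakModAlg W φ) (z : H) :
    φ ∘ₗ (TensorProduct.mk k H B).flip (u1 φ z) = u1 φ ∘ₗ LinearMap.mulRight k z := by
  ext h
  simp [u1_mul hφ]

/-- A map absorbing `u₂` on the left and equal to `u₁` on `1 ⊗ H` agrees with `u₂` on
`Π^L(H) ⊗ H`. -/
theorem apply_PiL_tmul {W : HopfData k H} (hW : IsWeakHopf W) {φ : H ⊗[k] B →ₗ[k] B}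
    (hφ : IsWeakModAlg W φ) {σ : H ⊗[k] H →ₗ[k] B} (hσ : conv k (δ2 W) (u2 φ) σ = σ)
    (h1 : ∀ h : H, σ ((1 : H) ⊗ₜ[k] h) = u1 φ h) (a h : H) :
    σ (PiL W a ⊗ₜ[k] h) = u1 φ (PiL W a * h) := by
  have pull : ∀ t s : H ⊗[k] H,
      LinearMap.mul' k B (TensorProduct.map (u2 φ) σ
        (TensorProduct.tensorTensorTensorComm k H H H H
          (((PiL W a ⊗ₜ[k] (1 : H)) * t) ⊗ₜ[k] s))) =
      u1 φ (PiL W a) * LinearMap.mul' k B (TensorProduct.map (u2 φ) σ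
        (TensorProduct.tensorTensorTensorComm k H H H H (t ⊗ₜ[k] s))) := by
    intro t s
    induction t with
    | zero => simp
    | add x y hx hy => simp only [map_add, mul_add, TensorProduct.add_tmul, hx, hy]
    | tmul b c =>
      induction s with
      | zero => simp
      | add x y hx hy => simp only [map_add, mul_add, TensorProduct.tmul_add, hx, hy]
      | tmul d e => simp [u2, mul_assoc, u1_PiL_mul hφ]
  rw [← hσ, conv_δ2_tmul, delta_PiL hW, pull, ← conv_δ2_tmul, hσ, h1, u1_PiL_mul hφ]

/-- A map absorbing `u₂` on the left and equal to `u₁` on `H ⊗ 1` agrees with `u₂` on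
`H ⊗ Π^L(H)`. -/
theorem apply_tmul_PiL {W : HopfData k H} (hW : IsWeakHopf W) (hcc : Cocomm W)
    {φ : H ⊗[k] B →ₗ[k] B}
    (hφ : IsWeakModAlg W φ) {σ : H ⊗[k] H →ₗ[k] B} (hσ : conv k (δ2 W) (u2 φ) σ = σ)
    (h1 : ∀ h : H, σ (h ⊗ₜ[k] (1 : H)) = u1 φ h) (h a : H) :
    σ (h ⊗ₜ[k] PiL W a) = u1 φ (h * PiL W a) := by
  let F : H ⊗[k] H → H ⊗[k] (H ⊗[k] H) →ₗ[k] B := fun t =>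
    LinearMap.mul' k B ∘ₗ TensorProduct.map (u1 φ ∘ₗ LinearMap.mulRight k (PiL W a))
      (LinearMap.mul' k B ∘ₗ TensorProduct.map (u2 φ) σ ∘ₗ
        (TensorProduct.tensorTensorTensorComm k H H H H).toLinearMap ∘ₗ
          (TensorProduct.mk k (H ⊗[k] H) (H ⊗[k] H)).flip t)
  have F_add : ∀ (x y : H ⊗[k] H) (r : H ⊗[k] (H ⊗[k] H)), F (x + y) r = F x r + F y r := by
    intro x y r
    simp only [F, map_add, LinearMap.comp_add, TensorProduct.map_add_right, LinearMap.add_apply]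
  have F_zero : ∀ r : H ⊗[k] (H ⊗[k] H), F 0 r = 0 := by
    intro r
    simp [F]
  have F_tmul : ∀ (c d b : H) (r : H ⊗[k] H),
      F (c ⊗ₜ[k] d) (TensorProduct.assoc k H H H (r ⊗ₜ[k] b)) =
        LinearMap.mul' k B (TensorProduct.map (u1 φ ∘ₗ LinearMap.mulRight k (PiL W a))
          (u1 φ ∘ₗ LinearMap.mulRight k c) r) * σ (b ⊗ₜ[k] d) := by
    intro c d b r
    induction r with
    | zero => simp
    | add x y hx hy => simp only [map_add, add_mul, TensorProduct.add_tmul, hx, hy]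
    | tmul x y => simp [F, u2, mul_assoc]
  have split : ∀ t s : H ⊗[k] H,
      LinearMap.mul' k B (TensorProduct.map (u2 φ) σ
        (TensorProduct.tensorTensorTensorComm k H H H H
          (s ⊗ₜ[k] ((PiL W a ⊗ₜ[k] (1 : H)) * LinearMap.rTensor H (PiL W) t)))) =
      F (LinearMap.rTensor H (PiL W) t)
        (TensorProduct.assoc k H H H (LinearMap.rTensor H W.δ s)) := by
    intro t s
    induction t with
    | zero => simp [F_zero]
    | add x y hx hy => simp only [map_add, mul_add, TensorProduct.tmul_add, F_add, hx, hy]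
    | tmul c d =>
      induction s with
      | zero => simp
      | add x y hx hy => simp only [map_add, TensorProduct.add_tmul, hx, hy]
      | tmul x y =>
        rw [LinearMap.rTensor_tmul, LinearMap.rTensor_tmul, F_tmul, ← flip_u1 hφ, ← flip_u1 hφ,
          ← hφ.2.1, ← u1_PiL_mul hφ, ← u1_mul hφ]
        simp [u2]
  have collapse : ∀ s : H ⊗[k] H,
      F (W.δ 1) (LinearMap.lTensor H W.δ s) =
        LinearMap.mul' k B
          (TensorProduct.map (u1 φ ∘ₗ LinearMap.mulRight k (PiL W a)) (u1 φ) s) := by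
    intro s
    induction s with
    | zero => simp
    | add x y hx hy => simp only [map_add, hx, hy]
    | tmul x y =>
      have e : LinearMap.mul' k B (TensorProduct.map (u2 φ) σ
          (TensorProduct.tensorTensorTensorComm k H H H H (W.δ y ⊗ₜ[k] W.δ 1))) = u1 φ y := by
        rw [← conv_δ2_tmul, hσ, h1]
      simp [F, e]
  have key := split (W.δ 1) (W.δ h)
  rw [rTensor_PiL_delta_one hW hcc, ← delta_PiL hW, ← conv_δ2_tmul, hσ, hW.coassoc, collapse,
    ← flip_u1 hφ] at key
  rw [key, u1_mul hφ]
  simpa [u1] using (hφ.2.1 h (u1 φ (PiL W a)) 1).symm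

theorem inv_one_tmul {W : HopfData k H} (hW : IsWeakHopf W) (hcc : Cocomm W)
    {φ : H ⊗[k] B →ₗ[k] B} (hφ : IsWeakModAlg W φ) {σ τ : H ⊗[k] H →ₗ[k] B}
    (hσ : conv k (δ2 W) (u2 φ) σ = σ) (hτ : conv k (δ2 W) (u2 φ) τ = τ)
    (hστ : conv k (δ2 W) σ τ = u2 φ)
    (h1 : ∀ h : H, σ ((1 : H) ⊗ₜ[k] h) = u1 φ h) (h : H) :
    τ ((1 : H) ⊗ₜ[k] h) = u1 φ h := by
  have agree : ∀ t s : H ⊗[k] H,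
      LinearMap.mul' k B (TensorProduct.map (u2 φ) τ
        (TensorProduct.tensorTensorTensorComm k H H H H
          (LinearMap.rTensor H (PiL W) t ⊗ₜ[k] s))) =
      LinearMap.mul' k B (TensorProduct.map σ τ
        (TensorProduct.tensorTensorTensorComm k H H H H
          (LinearMap.rTensor H (PiL W) t ⊗ₜ[k] s))) := by
    intro t s
    induction t with
    | zero => simp
    | add x y hx hy => simp only [map_add, TensorProduct.add_tmul, hx, hy]
    | tmul b c =>
      induction s with
      | zero => simp
      | add x y hx hy => simp only [map_add, TensorProduct.tmul_add, hx, hy]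
      | tmul d e => simp [u2, apply_PiL_tmul hW hφ hσ h1]
  have key := agree (W.δ 1) (W.δ h)
  rw [rTensor_PiL_delta_one hW hcc, ← conv_δ2_tmul, ← conv_δ2_tmul, hτ, hστ] at key
  simpa [u2] using key

theorem inv_tmul_one {W : HopfData k H} (hW : IsWeakHopf W) (hcc : Cocomm W)
    {φ : H ⊗[k] B →ₗ[k] B} (hφ : IsWeakModAlg W φ) {σ τ : H ⊗[k] H →ₗ[k] B}
    (hσ : conv k (δ2 W) (u2 φ) σ = σ) (hτ : conv k (δ2 W) (u2 φ) τ = τ)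
    (hστ : conv k (δ2 W) σ τ = u2 φ)
    (h1 : ∀ h : H, σ (h ⊗ₜ[k] (1 : H)) = u1 φ h) (h : H) :
    τ (h ⊗ₜ[k] (1 : H)) = u1 φ h := by
  have agree : ∀ t s : H ⊗[k] H,
      LinearMap.mul' k B (TensorProduct.map (u2 φ) τ
        (TensorProduct.tensorTensorTensorComm k H H H H
          (s ⊗ₜ[k] LinearMap.rTensor H (PiL W) t))) =
      LinearMap.mul' k B (TensorProduct.map σ τ
        (TensorProduct.tensorTensorTensorComm k H H H H
          (s ⊗ₜ[k] LinearMap.rTensor H (PiL W) t))) := by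
    intro t s
    induction t with
    | zero => simp
    | add x y hx hy => simp only [map_add, TensorProduct.tmul_add, hx, hy]
    | tmul b c =>
      induction s with
      | zero => simp
      | add x y hx hy => simp only [map_add, TensorProduct.add_tmul, hx, hy]
      | tmul d e => simp [u2, apply_tmul_PiL hW hcc hφ hσ h1]
  have key := agree (W.δ 1) (W.δ h)
  rw [rTensor_PiL_delta_one hW hcc, ← conv_δ2_tmul, ← conv_δ2_tmul, hτ, hστ] at key
  simpa [u2] using key

end NormalCocycle

/-- Let `H` be a cocommutative weak Hopf algebra, `(A, φ)` a
weak left `H`-module algebra and `σ ∈ Reg_{φ}(H⊗H, A)` with convolution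
inverse `σinv`.  Then (i) `σ∘(η⊗H) = u₁ ↔ σinv∘(η⊗H) = u₁` and
(ii) `σ∘(H⊗η) = u₁ ↔ σinv∘(H⊗η) = u₁`. -/
theorem statement7 {k H A : Type} [CommRing k] [Ring H] [Algebra k H]
    [Ring A] [Algebra k A]
    (W : HopfData k H) (hW : IsWeakHopf W) (hcc : Cocomm W)
    (φ : H ⊗[k] A →ₗ[k] A) (hφ : IsWeakModAlg W φ)
    (σ σinv : H ⊗[k] H →ₗ[k] A) (hreg : IsRegPair2 W φ σ σinv) :
    ((∀ h : H, σ ((1 : H) ⊗ₜ[k] h) = u1 φ h) ↔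
      (∀ h : H, σinv ((1 : H) ⊗ₜ[k] h) = u1 φ h)) ∧
    ((∀ h : H, σ (h ⊗ₜ[k] (1 : H)) = u1 φ h) ↔
      (∀ h : H, σinv (h ⊗ₜ[k] (1 : H)) = u1 φ h)) := by
  obtain ⟨h₁, h₂, h₃, h₄⟩ := hreg
  rw [h₁] at h₃
  rw [h₂] at h₄
  exact ⟨⟨inv_one_tmul hW hcc hφ h₃ h₄ h₁, inv_one_tmul hW hcc hφ h₄ h₃ h₂⟩,
    ⟨inv_tmul_one hW hcc hφ h₃ h₄ h₁, inv_tmul_one hW hcc hφ h₄ h₃ h₂⟩⟩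

end WHA

end
end

section
/- Let H be a cocommutative weak Hopf algebra over a commutative ring k, (A, φ_A) a weak left H-module algebra, and σ ∈ Reg_{φ_A}(H⊗H, A) satisfying the twisted condition (g1): μ_A∘(A⊗φ_A)∘(σ⊗μ_H⊗A)∘(δ_{H⊗H}⊗A) = μ_A∘((φ_A∘(H⊗φ_A))⊗A)∘(H⊗H⊗c_{A,A})∘(H⊗H⊗σ⊗A)∘(δ_{H⊗H}⊗A). Then the following are equivalent: (i) (A, φ_A) is a left H-module algebra (i.e. φ_A∘(μ_H⊗A)=φ_A∘(H⊗φ_A)); (ii) σ takes values in the center of A, i.e. μ_A∘(A⊗σ) = μ_A∘c_{A,A}∘(A⊗σ). -/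
open TensorProduct

noncomputable section

namespace WHA

variable (k : Type) [CommRing k]

variable (H : Type) [Ring H] [Algebra k H]

variable {k H}

section Convolution

variable {C D A B : Type} [AddCommGroup C] [Module k C] [AddCommGroup D] [Module k D]
  [Ring A] [Algebra k A] [Ring B] [Algebra k B]

lemma conv_apply (d : C →ₗ[k] C ⊗[k] C) (f g : C →ₗ[k] A) (c : C) :
    conv k d f g c = LinearMap.mul' k A (TensorProduct.map f g (d c)) := rfl

lemma conv_assoc (d : C →ₗ[k] C ⊗[k] C)
    (hd : ∀ c, TensorProduct.assoc k C C C (LinearMap.rTensor C d (d c)) =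
      LinearMap.lTensor C d (d c)) (f g h : C →ₗ[k] A) :
    conv k d (conv k d f g) h = conv k d f (conv k d g h) := by
  ext c
  have hr : ∀ t : C ⊗[k] C, LinearMap.mul' k A (TensorProduct.map f (conv k d g h) t) =
      LinearMap.mul' k A (TensorProduct.map f (LinearMap.mul' k A ∘ₗ TensorProduct.map g h)
        (LinearMap.lTensor C d t)) := by
    intro t
    induction t with
    | zero => simp
    | add s t hs ht => simp only [map_add, hs, ht]
    | tmul x y => simp [conv_apply]
  have hl : ∀ t : C ⊗[k] C, LinearMap.mul' k A (TensorProduct.map (conv k d f g) h t) =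
      LinearMap.mul' k A (TensorProduct.map (LinearMap.mul' k A ∘ₗ TensorProduct.map f g) h
        (LinearMap.rTensor C d t)) := by
    intro t
    induction t with
    | zero => simp
    | add s t hs ht => simp only [map_add, hs, ht]
    | tmul x y => simp [conv_apply]
  have ha : ∀ t : (C ⊗[k] C) ⊗[k] C,
      LinearMap.mul' k A
        (TensorProduct.map (LinearMap.mul' k A ∘ₗ TensorProduct.map f g) h t) =
      LinearMap.mul' k A
        (TensorProduct.map f (LinearMap.mul' k A ∘ₗ TensorProduct.map g h)
          (TensorProduct.assoc k C C C t)) := by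
    intro t
    induction t with
    | zero => simp
    | add s t hs ht => simp only [map_add, hs, ht]
    | tmul s z =>
      induction s with
      | zero => simp
      | add s t hs ht => simp only [TensorProduct.add_tmul, map_add, hs, ht]
      | tmul x y => simp [mul_assoc]
  rw [conv_apply, conv_apply, hl, hr, ha, hd]

/-- Precomposition with a comultiplicative map preserves convolution. -/
lemma conv_comp_comultiplicative (d : C →ₗ[k] C ⊗[k] C) (d' : D →ₗ[k] D ⊗[k] D)
    (m : D →ₗ[k] C) (hm : ∀ c, d (m c) = TensorProduct.map m m (d' c)) (f g : C →ₗ[k] A) :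
    conv k d' (f ∘ₗ m) (g ∘ₗ m) = conv k d f g ∘ₗ m := by
  ext c
  rw [LinearMap.comp_apply, conv_apply, conv_apply, hm, TensorProduct.map_comp,
    LinearMap.comp_apply]

/-- Postcomposition with a multiplicative map preserves convolution. -/
lemma conv_multiplicative_comp (d : C →ₗ[k] C ⊗[k] C) (m : A →ₗ[k] B)
    (hm : ∀ a b, m (a * b) = m a * m b) (f g : C →ₗ[k] A) :
    conv k d (m ∘ₗ f) (m ∘ₗ g) = m ∘ₗ conv k d f g := by
  ext c
  simp only [LinearMap.comp_apply, conv_apply]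
  induction d c with
  | zero => simp
  | add s t hs ht => simp only [map_add, hs, ht]
  | tmul x y => simp [hm]

lemma conv_mulLeft_apply (d : C →ₗ[k] C ⊗[k] C) (f : C →ₗ[k] A)
    (F : C →ₗ[k] Module.End k A) (c : C) (a : A) :
    conv k d (LinearMap.mul k A ∘ₗ f) F c a =
      LinearMap.mul' k A (TensorProduct.map f (F.flip a) (d c)) := by
  rw [conv_apply]
  induction d c with
  | zero => simp
  | add s t hs ht => simp only [map_add, LinearMap.add_apply, hs, ht]
  | tmul x y => simp

lemma conv_mulRight_apply (d : C →ₗ[k] C ⊗[k] C)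
    (hd : ∀ c, TensorProduct.comm k C C (d c) = d c) (f : C →ₗ[k] A)
    (F : C →ₗ[k] Module.End k A) (c : C) (a : A) :
    conv k d ((LinearMap.mul k A).flip ∘ₗ f) F c a =
      LinearMap.mul' k A (TensorProduct.map (F.flip a) f (d c)) := by
  rw [conv_apply]
  nth_rewrite 1 [← hd c]
  induction d c with
  | zero => simp
  | add s t hs ht => simp only [map_add, LinearMap.add_apply, hs, ht]
  | tmul x y => simp

end Convolution

section TensorCoalgebra

lemma δ2_coassoc {W : HopfData k H} (hW : IsWeakHopf W) (c : H ⊗[k] H) :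
    TensorProduct.assoc k _ _ _ (LinearMap.rTensor (H ⊗[k] H) (δ2 W) (δ2 W c)) =
      LinearMap.lTensor (H ⊗[k] H) (δ2 W) (δ2 W c) := by
  let : Coalgebra k H :=
    { comul := W.δ
      counit := W.ε
      coassoc := LinearMap.ext hW.coassoc
      rTensor_counit_comp_comul := by
        ext h
        apply (TensorProduct.lid k H).injective
        simpa using hW.counit_left h
      lTensor_counit_comp_comul := by
        ext h
        apply (TensorProduct.rid k H).injective
        simpa using hW.counit_right h }
  exact Coalgebra.coassoc_apply (R := k) (A := H ⊗[k] H) c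

lemma comm_tensorTensorTensorComm (s t : H ⊗[k] H) :
    TensorProduct.comm k _ _ (TensorProduct.tensorTensorTensorComm k H H H H (s ⊗ₜ[k] t)) =
      TensorProduct.tensorTensorTensorComm k H H H H
        (TensorProduct.comm k H H s ⊗ₜ[k] TensorProduct.comm k H H t) := by
  induction s with
  | zero => simp
  | add s s' hs hs' => simp only [TensorProduct.add_tmul, map_add, hs, hs']
  | tmul x y =>
    induction t with
    | zero => simp
    | add t t' ht ht' => simp only [TensorProduct.tmul_add, map_add, ht, ht']
    | tmul z w => simp

lemma δ2_cocomm {W : HopfData k H} (hcc : Cocomm W) (c : H ⊗[k] H) :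
    TensorProduct.comm k _ _ (δ2 W c) = δ2 W c := by
  induction c with
  | zero => simp
  | add s t hs ht => simp only [map_add, hs, ht]
  | tmul x y =>
    change TensorProduct.comm k _ _ (TensorProduct.tensorTensorTensorComm k H H H H
      (W.δ x ⊗ₜ[k] W.δ y)) = TensorProduct.tensorTensorTensorComm k H H H H
      (W.δ x ⊗ₜ[k] W.δ y)
    rw [comm_tensorTensorTensorComm, hcc x, hcc y]

lemma map_mul'_tensorTensorTensorComm (s t : H ⊗[k] H) :
    TensorProduct.map (LinearMap.mul' k H) (LinearMap.mul' k H)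
      (TensorProduct.tensorTensorTensorComm k H H H H (s ⊗ₜ[k] t)) = s * t := by
  induction s with
  | zero => simp
  | add s s' hs hs' => simp only [TensorProduct.add_tmul, map_add, hs, hs', add_mul]
  | tmul x y =>
    induction t with
    | zero => simp
    | add t t' ht ht' => simp only [TensorProduct.tmul_add, map_add, ht, ht', mul_add]
    | tmul z w => simp

/-- The product of a weak Hopf algebra is comultiplicative. -/
lemma δ_mul' {W : HopfData k H} (hW : IsWeakHopf W) (c : H ⊗[k] H) :
    W.δ (LinearMap.mul' k H c) =
      TensorProduct.map (LinearMap.mul' k H) (LinearMap.mul' k H) (δ2 W c) := by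
  induction c with
  | zero => simp
  | add s t hs ht => simp only [map_add, hs, ht]
  | tmul x y =>
    change _ = TensorProduct.map (LinearMap.mul' k H) (LinearMap.mul' k H)
      (TensorProduct.tensorTensorTensorComm k H H H H (W.δ x ⊗ₜ[k] W.δ y))
    rw [map_mul'_tensorTensorTensorComm, LinearMap.mul'_apply, hW.a1]

end TensorCoalgebra

/-- The map `p ⊗ w ↦ ε(p * h) • w`. -/
def counitMulLeft (W : HopfData k H) (h : H) (M : Type) [AddCommGroup M] [Module k M] :
    H ⊗[k] M →ₗ[k] M :=
  (TensorProduct.lid k M).toLinearMap ∘ₗ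
    LinearMap.rTensor M (W.ε ∘ₗ LinearMap.mulRight k h)

lemma counitMulLeft_tmul (W : HopfData k H) (h : H) {M : Type} [AddCommGroup M] [Module k M]
    (p : H) (w : M) : counitMulLeft W h M (p ⊗ₜ[k] w) = W.ε (p * h) • w := by
  simp [counitMulLeft]

lemma PiL_eq_counitMulLeft (W : HopfData k H) (h : H) :
    PiL W h = counitMulLeft W h H (W.δ 1) := by
  simp only [PiL, LinearMap.comp_apply, TensorProduct.mk_apply]
  induction W.δ 1 with
  | zero => simp
  | add s t hs ht => simp only [TensorProduct.add_tmul, map_add, hs, ht]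
  | tmul x y => simp [counitMulLeft_tmul]

/-- `δ(Π^L(h)) = 1₍₁₎ Π^L(h) ⊗ 1₍₂₎`. -/
lemma δ_PiL {W : HopfData k H} (hW : IsWeakHopf W) (h : H) :
    W.δ (PiL W h) = W.δ 1 * (PiL W h ⊗ₜ[k] (1 : H)) := by
  have hl : ∀ t : H ⊗[k] H,
      counitMulLeft W h (H ⊗[k] H) (LinearMap.lTensor H W.δ t) =
        W.δ (counitMulLeft W h H t) := by
    intro t
    induction t with
    | zero => simp
    | add s t hs ht => simp only [map_add, hs, ht]
    | tmul x y => simp [counitMulLeft_tmul]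
  have hr : ∀ d t : H ⊗[k] H,
      counitMulLeft W h (H ⊗[k] H)
        ((Algebra.TensorProduct.includeRight :
            (H ⊗[k] H) →ₐ[k] H ⊗[k] (H ⊗[k] H)).toLinearMap d *
          (TensorProduct.map LinearMap.id
            (Algebra.TensorProduct.includeLeft : H →ₐ[k] H ⊗[k] H).toLinearMap) t) =
        d * (counitMulLeft W h H t ⊗ₜ[k] (1 : H)) := by
    intro d t
    induction t with
    | zero => simp
    | add s t hs ht => simp only [map_add, mul_add, TensorProduct.add_tmul, hs, ht]
    | tmul x y => simp [counitMulLeft_tmul, ← TensorProduct.smul_tmul']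
  rw [PiL_eq_counitMulLeft, ← hl, ← hW.coassoc, hW.a3', hr]

section WeakAction

variable {A : Type} [Ring A] [Algebra k A]

/-- The iterated weak action `x ⊗ y ↦ (b ↦ x · (y · b))`. -/
def iterAct (φ : H ⊗[k] A →ₗ[k] A) : H ⊗[k] H →ₗ[k] Module.End k A :=
  LinearMap.mul' k (Module.End k A) ∘ₗ
    TensorProduct.map (TensorProduct.curry φ) (TensorProduct.curry φ)

lemma iterAct_tmul (φ : H ⊗[k] A →ₗ[k] A) (x y : H) (a : A) :
    iterAct φ (x ⊗ₜ[k] y) a = φ (x ⊗ₜ[k] φ (y ⊗ₜ[k] a)) := by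
  simp [iterAct]

lemma u1_apply (φ : H ⊗[k] A →ₗ[k] A) (h : H) : u1 φ h = φ (h ⊗ₜ[k] (1 : A)) := rfl

/-- For cocommutative `H`, the values `h · 1` of a weak action are central. -/
lemma u1_central {W : HopfData k H} (hW : IsWeakHopf W) (hcc : Cocomm W)
    {φ : H ⊗[k] A →ₗ[k] A} (hφ : IsWeakModAlg W φ) (h : H) (a : A) :
    u1 φ h * a = a * u1 φ h := by
  obtain ⟨d1, d2, d3, d4⟩ := hφ
  have hz : φ (PiL W h ⊗ₜ[k] (1 : A)) = u1 φ h := by rw [d4, mul_one, u1_apply]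
  have key : ∀ (z : H) (t : H ⊗[k] H),
      LinearMap.mul' k A (TensorProduct.map (φ ∘ₗ (TensorProduct.mk k H A).flip a)
        (φ ∘ₗ (TensorProduct.mk k H A).flip 1)
          (TensorProduct.comm k H H (t * (z ⊗ₜ[k] (1 : H))))) =
      LinearMap.mul' k A (TensorProduct.map (φ ∘ₗ (TensorProduct.mk k H A).flip a)
        (φ ∘ₗ (TensorProduct.mk k H A).flip (φ (z ⊗ₜ[k] (1 : A))))
          (TensorProduct.comm k H H t)) := by
    intro z t
    induction t with
    | zero => simp
    | add s t hs ht => simp only [add_mul, map_add, hs, ht]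
    | tmul x y => simp [d3]
  calc u1 φ h * a = φ (PiL W h ⊗ₜ[k] (a * 1)) := by rw [mul_one, d4, u1_apply]
    _ = φ ((1 : H) ⊗ₜ[k] (a * φ (PiL W h ⊗ₜ[k] (1 : A)))) := by
      rw [d2, ← hcc, δ_PiL hW, key, hcc, ← d2]
    _ = a * u1 φ h := by rw [d1, hz]

/-- A weak action absorbs the convolution idempotent `u₁`. -/
lemma conv_u1_curry {W : HopfData k H} {φ : H ⊗[k] A →ₗ[k] A} (hφ : IsWeakModAlg W φ) :
    conv k W.δ (LinearMap.mul k A ∘ₗ u1 φ) (TensorProduct.curry φ) =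
      TensorProduct.curry φ := by
  ext h a
  rw [conv_mulLeft_apply]
  exact (hφ.2.1 h 1 a).symm.trans (by rw [one_mul]; rfl)

/-- The iterated weak action absorbs the convolution idempotent `u₂`. -/
lemma conv_u2_iterAct {W : HopfData k H} {φ : H ⊗[k] A →ₗ[k] A} (hφ : IsWeakModAlg W φ) :
    conv k (δ2 W) (LinearMap.mul k A ∘ₗ u2 φ) (iterAct φ) = iterAct φ := by
  obtain ⟨d1, d2, d3, d4⟩ := hφ
  refine TensorProduct.ext' fun x y => LinearMap.ext fun a => ?_
  rw [conv_mulLeft_apply]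
  have inner : ∀ (y₁ y₂ : H) (s : H ⊗[k] H),
      LinearMap.mul' k A (TensorProduct.map (u2 φ) ((iterAct φ).flip a)
        (TensorProduct.tensorTensorTensorComm k H H H H (s ⊗ₜ[k] (y₁ ⊗ₜ[k] y₂)))) =
      LinearMap.mul' k A (TensorProduct.map
        (φ ∘ₗ (TensorProduct.mk k H A).flip (φ (y₁ ⊗ₜ[k] (1 : A))))
        (φ ∘ₗ (TensorProduct.mk k H A).flip (φ (y₂ ⊗ₜ[k] a))) s) := by
    intro y₁ y₂ s
    induction s with
    | zero => simp
    | add s t hs ht => simp only [TensorProduct.add_tmul, map_add, hs, ht]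
    | tmul x₁ x₂ => simp [iterAct_tmul, u2, u1_apply, d3]
  have outer : ∀ t : H ⊗[k] H,
      LinearMap.mul' k A (TensorProduct.map (u2 φ) ((iterAct φ).flip a)
        (TensorProduct.tensorTensorTensorComm k H H H H (W.δ x ⊗ₜ[k] t))) =
      φ (x ⊗ₜ[k] LinearMap.mul' k A (TensorProduct.map
        (φ ∘ₗ (TensorProduct.mk k H A).flip 1) (φ ∘ₗ (TensorProduct.mk k H A).flip a) t)) := by
    intro t
    induction t with
    | zero => simp
    | add s t hs ht => simp only [TensorProduct.tmul_add, map_add, hs, ht]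
    | tmul y₁ y₂ => rw [inner, ← d2]; simp
  refine (outer (W.δ y)).trans ?_
  rw [← d2, one_mul, iterAct_tmul]

/-- The twisted condition as an identity of convolution products in `Hom(H ⊗ H, End A)`. -/
lemma CrossedG1.conv_eq {W : HopfData k H} (hcc : Cocomm W) {φ : H ⊗[k] A →ₗ[k] A}
    {σ : H ⊗[k] H →ₗ[k] A} (htw : CrossedG1 W φ σ) :
    conv k (δ2 W) (LinearMap.mul k A ∘ₗ σ) (TensorProduct.curry φ ∘ₗ LinearMap.mul' k H) =
      conv k (δ2 W) ((LinearMap.mul k A).flip ∘ₗ σ) (iterAct φ) := by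
  refine TensorProduct.ext' fun x y => LinearMap.ext fun a => ?_
  have hG : (iterAct φ).flip a =
      φ ∘ₗ LinearMap.lTensor H (φ ∘ₗ (TensorProduct.mk k H A).flip a) :=
    TensorProduct.ext' fun x y => by simp [iterAct_tmul]
  rw [conv_mulLeft_apply,
    conv_mulRight_apply (δ2 W) (δ2_cocomm hcc) σ (iterAct φ) (x ⊗ₜ[k] y) a, hG]
  exact htw x y a

lemma mul_mul_hom (a b : A) :
    LinearMap.mul k A (a * b) = LinearMap.mul k A a * LinearMap.mul k A b :=
  LinearMap.ext fun c => by simp [mul_assoc]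

/-- If `φ` is an action, then `h ↦ λ(h) · -` is a convolution inverse of it, relative to `u₂`. -/
lemma conv_action_antipode {W : HopfData k H} (hW : IsWeakHopf W)
    {φ : H ⊗[k] A →ₗ[k] A} (hφ : IsWeakModAlg W φ)
    (hact : ∀ (g h : H) (b : A), φ ((g * h) ⊗ₜ[k] b) = φ (g ⊗ₜ[k] φ (h ⊗ₜ[k] b))) :
    conv k (δ2 W) (TensorProduct.curry φ ∘ₗ LinearMap.mul' k H)
        ((TensorProduct.curry φ ∘ₗ W.lam) ∘ₗ LinearMap.mul' k H) =
      LinearMap.mul k A ∘ₗ u2 φ := by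
  rw [conv_comp_comultiplicative W.δ (δ2 W) _ (δ_mul' hW)]
  have hcomp := conv_multiplicative_comp W.δ (TensorProduct.curry φ)
    (fun x y => LinearMap.ext fun a => by simp [hact]) LinearMap.id W.lam
  rw [LinearMap.comp_id] at hcomp
  rw [hcomp]
  refine LinearMap.ext fun c => LinearMap.ext fun a => ?_
  simp only [LinearMap.comp_apply, TensorProduct.curry_apply, conv_apply]
  rw [hW.a4_left, hφ.2.2.2]
  simp [u2, u1_apply]

lemma conv_mulLeft_u2 {W : HopfData k H} (hW : IsWeakHopf W) (hcc : Cocomm W)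
    {φ : H ⊗[k] A →ₗ[k] A} (hφ : IsWeakModAlg W φ) {σ : H ⊗[k] H →ₗ[k] A}
    (hσ : conv k (δ2 W) (u2 φ) σ = σ) :
    conv k (δ2 W) (LinearMap.mul k A ∘ₗ σ) (LinearMap.mul k A ∘ₗ u2 φ) =
      LinearMap.mul k A ∘ₗ σ := by
  rw [conv_multiplicative_comp (δ2 W) (LinearMap.mul k A) mul_mul_hom]
  congr 1
  refine Eq.trans (LinearMap.ext fun c => ?_) hσ
  rw [conv_apply, conv_apply]
  nth_rewrite 1 [← δ2_cocomm hcc c]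
  induction δ2 W c with
  | zero => simp
  | add s t hs ht => simp only [map_add, hs, ht]
  | tmul x y => simp [u2, u1_central hW hcc hφ]

lemma conv_mulRight_u2 {W : HopfData k H} (hW : IsWeakHopf W) (hcc : Cocomm W)
    {φ : H ⊗[k] A →ₗ[k] A} (hφ : IsWeakModAlg W φ) {σ : H ⊗[k] H →ₗ[k] A}
    (hσ : conv k (δ2 W) (u2 φ) σ = σ) :
    conv k (δ2 W) ((LinearMap.mul k A).flip ∘ₗ σ) (LinearMap.mul k A ∘ₗ u2 φ) =
      (LinearMap.mul k A).flip ∘ₗ σ := by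
  refine LinearMap.ext fun c => LinearMap.ext fun a => ?_
  rw [conv_mulRight_apply (δ2 W) (δ2_cocomm hcc) σ (LinearMap.mul k A ∘ₗ u2 φ) c a]
  nth_rewrite 2 [← hσ]
  rw [LinearMap.comp_apply, conv_apply]
  induction δ2 W c with
  | zero => simp
  | add s t hs ht => simp only [map_add, LinearMap.add_apply, hs, ht]
  | tmul x y => simp [u2, u1_central hW hcc hφ, mul_assoc]

end WeakAction

/-- Let `H` be a cocommutative weak Hopf algebra, `(A, φ)` a
weak left `H`-module algebra and `σ ∈ Reg_{φ}(H⊗H, A)` satisfying the twisted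
condition (g1).  Then `(A, φ)` is a left `H`-module algebra iff `σ` takes
values in the center of `A`. -/
theorem statement8 {k H A : Type} [CommRing k] [Ring H] [Algebra k H]
    [Ring A] [Algebra k A]
    (W : HopfData k H) (hW : IsWeakHopf W) (hcc : Cocomm W)
    (φ : H ⊗[k] A →ₗ[k] A) (hφ : IsWeakModAlg W φ)
    (σ σinv : H ⊗[k] H →ₗ[k] A) (hreg : IsRegPair2 W φ σ σinv)
    (htw : CrossedG1 W φ σ) :
    (∀ (g h : H) (b : A), φ ((g * h) ⊗ₜ[k] b) = φ (g ⊗ₜ[k] φ (h ⊗ₜ[k] b))) ↔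
    (∀ (a : A) (x y : H), a * σ (x ⊗ₜ[k] y) = σ (x ⊗ₜ[k] y) * a) := by
  obtain ⟨hσr, hσl, hσ, -⟩ := hreg
  rw [hσr] at hσ
  have hassoc := conv_assoc (A := Module.End k A) (δ2 W) (δ2_coassoc hW)
  have htw' := htw.conv_eq hcc
  constructor
  · intro hact
    have hiter : iterAct φ = TensorProduct.curry φ ∘ₗ LinearMap.mul' k H :=
      TensorProduct.ext' fun x y => LinearMap.ext fun a => by simp [iterAct_tmul, hact]
    rw [hiter] at htw'
    have hconv := congrArg (fun f => conv k (δ2 W) f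
      ((TensorProduct.curry φ ∘ₗ W.lam) ∘ₗ LinearMap.mul' k H)) htw'
    beta_reduce at hconv
    rw [hassoc, hassoc, conv_action_antipode hW hφ hact, conv_mulLeft_u2 hW hcc hφ hσ,
      conv_mulRight_u2 hW hcc hφ hσ] at hconv
    intro a x y
    exact (LinearMap.congr_fun (LinearMap.congr_fun hconv (x ⊗ₜ[k] y)) a).symm
  · intro hcen
    have hflip : (LinearMap.mul k A).flip ∘ₗ σ = LinearMap.mul k A ∘ₗ σ :=
      TensorProduct.ext' fun x y => LinearMap.ext fun a => by simp [hcen]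
    have hinv : conv k (δ2 W) (LinearMap.mul k A ∘ₗ σinv) (LinearMap.mul k A ∘ₗ σ) =
        LinearMap.mul k A ∘ₗ u2 φ := by
      rw [conv_multiplicative_comp (δ2 W) (LinearMap.mul k A) mul_mul_hom, hσl]
    have hprod : conv k (δ2 W) (LinearMap.mul k A ∘ₗ u2 φ)
        (TensorProduct.curry φ ∘ₗ LinearMap.mul' k H) =
        TensorProduct.curry φ ∘ₗ LinearMap.mul' k H := by
      have hcomp := conv_comp_comultiplicative W.δ (δ2 W) (LinearMap.mul' k H) (δ_mul' hW)
        (LinearMap.mul k A ∘ₗ u1 φ) (TensorProduct.curry φ)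
      rwa [conv_u1_curry hφ] at hcomp
    have hconv := congrArg (fun f => conv k (δ2 W) (LinearMap.mul k A ∘ₗ σinv) f) htw'
    beta_reduce at hconv
    rw [hflip, ← hassoc, ← hassoc, hinv, hprod, conv_u2_iterAct hφ] at hconv
    intro g h b
    exact (LinearMap.congr_fun (LinearMap.congr_fun hconv (g ⊗ₜ[k] h)) b).trans
      (iterAct_tmul φ g h b)

end WHA

end
end
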